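/- arXiv:1808.04047 — 11 statements merged into one kernel-verified Lean document; each statement's English description precedes it below -/
import Mathlib

section
/- Every embedded graph has a checkerboard colourable twisted dual; that is, for every ribbon graph G there exist a partition A_1,…,A_6 of E(G) such that the twisted dual G^{∏_{i=1}^{6} ξ_i(A_i)}, where ξ_1,…,ξ_6 are the six elements of ⟨δ, τ | δ², τ², (δτ)³⟩, is checkerboard colourable. -/
/-!
A combinatorial model of ribbon graphs (embedded graphs) via flag systems
(graph-encoded maps): a set of flags together with three involutions
`t0` (change vertex), `t1` (change edge), `t2` (change face), where `t0` and
`t2` commute.  Vertices are the orbits of `⟨t1,t2⟩`, edges the orbits of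
`⟨t0,t2⟩`, and faces (= boundary components of the ribbon graph) the orbits
of `⟨t0,t1⟩`.
-/

structure RibbonGraph where
  flags : Type
  t0 : flags → flags
  t1 : flags → flags
  t2 : flags → flags

namespace RibbonGraph

open Classical

/-- The axioms making a flag system a genuine ribbon graph (gem):
finiteness, the three maps are fixed-point-free involutions, and
`t0`, `t2` commute with `t0 ∘ t2` fixed-point-free. -/
def IsRibbon (G : RibbonGraph) : Prop :=
  Finite G.flags ∧
  Function.Involutive G.t0 ∧ Function.Involutive G.t1 ∧ Function.Involutive G.t2 ∧
  (∀ x, G.t0 (G.t2 x) = G.t2 (G.t0 x)) ∧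
  (∀ x, G.t0 x ≠ x) ∧ (∀ x, G.t1 x ≠ x) ∧ (∀ x, G.t2 x ≠ x) ∧
  (∀ x, G.t0 (G.t2 x) ≠ x)

/-- A set of flags represents a subset `A ⊆ E(G)` of the edge set iff it is a
union of edge orbits, i.e. closed under `t0` and `t2`. -/
def IsEdgeSet (G : RibbonGraph) (A : Set G.flags) : Prop :=
  ∀ x ∈ A, G.t0 x ∈ A ∧ G.t2 x ∈ A

/-- The edge of `G` containing the flag `x`, as its `⟨t0,t2⟩`-orbit. -/
def edgeOf (G : RibbonGraph) (x : G.flags) : Set G.flags :=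
  {x, G.t0 x, G.t2 x, G.t0 (G.t2 x)}

/-- Partial dual `G^{δ(A)}`: interchange the roles of `t0` and `t2`
on the flags of the edges in `A`. -/
noncomputable def pdual (G : RibbonGraph) (A : Set G.flags) : RibbonGraph where
  flags := G.flags
  t0 := fun x => if x ∈ A then G.t2 x else G.t0 x
  t1 := G.t1
  t2 := fun x => if x ∈ A then G.t0 x else G.t2 x

/-- Partial Petrial `G^{τ(A)}` (half-twist on each edge of `A`):
replace `t0` by `t0 ∘ t2` on the flags of the edges in `A`. -/
noncomputable def ppetrial (G : RibbonGraph) (A : Set G.flags) : RibbonGraph where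
  flags := G.flags
  t0 := fun x => if x ∈ A then G.t0 (G.t2 x) else G.t0 x
  t1 := G.t1
  t2 := G.t2

/-- Geometric dual `G*`. -/
noncomputable def gdual (G : RibbonGraph) : RibbonGraph := G.pdual Set.univ

/-- Petrial `G^×`. -/
noncomputable def petrial (G : RibbonGraph) : RibbonGraph := G.ppetrial Set.univ

/-- Auxiliary function for edge deletion: starting from a flag, skip (around
the vertex) over the flags of deleted edges until a surviving flag is found. -/
noncomputable def delSkip (G : RibbonGraph) (A : Set G.flags) : ℕ → G.flags → G.flags
  | 0, y => y
  | n + 1, y => if y ∈ A then G.delSkip A n (G.t1 (G.t2 y)) else y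

/-- Deletion `G − A` of the set of edges `A`: discard the flags of the edges
in `A`; `t0` and `t2` restrict, and the corner involution `t1` skips over the
deleted edges around each vertex. -/
noncomputable def del (G : RibbonGraph) (A : Set G.flags) : RibbonGraph where
  flags := {x : G.flags // x ∉ A}
  t0 := fun x => if h : G.t0 x.1 ∉ A then ⟨G.t0 x.1, h⟩ else x
  t1 := fun x =>
    if h : G.delSkip A (Nat.card G.flags + 1) (G.t1 x.1) ∉ A then
      ⟨G.delSkip A (Nat.card G.flags + 1) (G.t1 x.1), h⟩
    else x
  t2 := fun x => if h : G.t2 x.1 ∉ A then ⟨G.t2 x.1, h⟩ else x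

/-- Contraction `G/A := G^A − A`. -/
noncomputable def contract (G : RibbonGraph) (A : Set G.flags) : RibbonGraph :=
  (G.pdual A).del A

/-- `G − B/C`: delete the edges of `B` and contract the edges of `C`
(for disjoint `B`, `C`). -/
noncomputable def delContract (G : RibbonGraph) (B C : Set G.flags) : RibbonGraph :=
  (G.pdual C).del (B ∪ C)

/-- Isomorphism (equality as embedded graphs): a flag bijection commuting
with the three involutions. -/
def Iso (G H : RibbonGraph) : Prop :=
  ∃ e : G.flags ≃ H.flags,
    (∀ x, e (G.t0 x) = H.t0 (e x)) ∧
    (∀ x, e (G.t1 x) = H.t1 (e x)) ∧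
    (∀ x, e (G.t2 x) = H.t2 (e x))

/-- Orientability of the ribbon graph as a surface with boundary:
the flag graph is bipartite. -/
def Orientable (G : RibbonGraph) : Prop :=
  ∃ c : G.flags → Bool, ∀ x,
    c (G.t0 x) = !c x ∧ c (G.t1 x) = !c x ∧ c (G.t2 x) = !c x

/-- Checkerboard colourability: a red/blue colouring of the flags, constant
on faces (`⟨t0,t1⟩`-orbits), such that the two faces on the two sides of any
edge (related by `t2`) receive different colours. -/
def CheckerboardColourable (G : RibbonGraph) : Prop :=
  ∃ c : G.flags → Bool, ∀ x,
    c (G.t0 x) = c x ∧ c (G.t1 x) = c x ∧ c (G.t2 x) = !c x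

/-- Bipartiteness (no odd cycles): a proper two-colouring of the flags,
constant on vertices (`⟨t1,t2⟩`-orbits), with the two endpoints of any edge
(related by `t0`) coloured differently. -/
def Bipartite (G : RibbonGraph) : Prop :=
  ∃ c : G.flags → Bool, ∀ x,
    c (G.t0 x) = !c x ∧ c (G.t1 x) = c x ∧ c (G.t2 x) = c x

/-- Two flags lie at the same vertex iff they are in the same
`⟨t1,t2⟩`-orbit. -/
def sameVertex (G : RibbonGraph) : G.flags → G.flags → Prop :=
  Relation.ReflTransGen (fun a b => G.t1 a = b ∨ G.t2 a = b)

/-- The degree of the vertex containing the flag `x`: half the number of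
flags in its `⟨t1,t2⟩`-orbit. -/
noncomputable def degree (G : RibbonGraph) (x : G.flags) : ℕ :=
  ({y | G.sameVertex x y}).ncard / 2

/-- Eulerian: every vertex has even degree. -/
def Eulerian (G : RibbonGraph) : Prop := ∀ x, Even (G.degree x)

/-- An all-crossing direction of the medial graph `G_m`, encoded on the flags
of `G`: edges of `G_m` correspond to `t1`-pairs of flags (corners of `G`) and
`o x` records whether the corner at `x` is directed out of the edge of `x`.
The first condition says each medial edge gets one consistent direction; the
second says that around each medial vertex (edge of `G`, whose four corners
occur in cyclic order `x, t0 x, t2 (t0 x), t2 x`) the directions read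
head, head, tail, tail. -/
def IsAllCrossing (G : RibbonGraph) (o : G.flags → Bool) : Prop :=
  (∀ x, o (G.t1 x) = !o x) ∧ (∀ x, o (G.t0 (G.t2 x)) = !o x)

/-- The set of `d`-edges of `G` arising from an all-crossing direction `o`
of the medial graph. -/
def dEdges (G : RibbonGraph) (o : G.flags → Bool) : Set G.flags :=
  {x | o (G.t0 x) = o x}

/-- Generators of the group `⟨δ, τ | δ², τ², (δτ)³⟩` of twisted duality. -/
inductive GenOp | d | t

/-- Apply a word in `δ, τ` partially, with respect to a fixed set of edges. -/
noncomputable def applyWord : List GenOp → (G : RibbonGraph) → Set G.flags → RibbonGraph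
  | [], G, _ => G
  | GenOp.d :: w, G, A => applyWord w (G.pdual A) A
  | GenOp.t :: w, G, A => applyWord w (G.ppetrial A) A

/-- The twisted dual `G^{∏ᵢ ξᵢ(Aᵢ)}` determined by a partition
`A : Fin 6 → Set G.flags` of the edge set, where `ξ₀,…,ξ₅` are the six
elements `1, δ, τ, δτ, τδ, δτδ` of `⟨δ, τ | δ², τ², (δτ)³⟩`.
(The six operations act on disjoint sets of edges, so they commute.) -/
noncomputable def twistedDual (G : RibbonGraph) (A : Fin 6 → Set G.flags) : RibbonGraph :=
  applyWord [GenOp.d, GenOp.t, GenOp.d]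
    (applyWord [GenOp.t, GenOp.d]
      (applyWord [GenOp.d, GenOp.t]
        (applyWord [GenOp.t]
          (applyWord [GenOp.d]
            (applyWord [] G (A 0)) (A 1)) (A 2)) (A 3)) (A 4)) (A 5)

end RibbonGraph
/-- Two fixed-point-free involutions `a`, `b` admit a two-colouring flipped by both:
no `⟨b ∘ a⟩`-orbit is preserved by `a`, so it suffices to colour the pairs of such orbits. -/
theorem exists_bool_flipped_by_involutions {X : Type*} {a b : X → X}
    (ha : Function.Involutive a) (hb : Function.Involutive b)
    (ha' : ∀ x, a x ≠ x) (hb' : ∀ x, b x ≠ x) :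
    ∃ c : X → Bool, ∀ x, c (a x) = !c x ∧ c (b x) = !c x := by
  classical
  let α := ha.toPerm a
  let β := hb.toPerm b
  set p := β * α with hp
  have hαα : α * α = 1 := Equiv.ext ha
  have hββ : β * β = 1 := Equiv.ext hb
  have hαi : α⁻¹ = α := inv_eq_of_mul_eq_one_left hαα
  have hβi : β⁻¹ = β := inv_eq_of_mul_eq_one_left hββ
  have hconj : α * p * α⁻¹ = p⁻¹ := by
    rw [hp, mul_inv_rev, hαi, hβi, mul_assoc, mul_assoc, hαα, mul_one]
  have hcomm (n : ℤ) (x : X) : a ((p ^ n) x) = (p ^ (-n)) (a x) := by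
    have h : α * p ^ n = p ^ (-n) * α := by
      rw [zpow_neg, ← inv_zpow, ← hconj, conj_zpow, inv_mul_cancel_right]
    exact DFunLike.congr_fun h x
  have hbp (x : X) : b x = p (a x) := congrArg b (ha x).symm
  have hne (x : X) : ¬ p.SameCycle x (a x) := by
    rintro ⟨n, hn⟩
    obtain ⟨k, rfl | rfl⟩ := Int.even_or_odd' n
    · refine ha' ((p ^ k) x) ?_
      rw [hcomm, ← hn, ← Equiv.Perm.mul_apply, ← zpow_add]
      congr 2
      ring
    · refine hb' ((p ^ (k + 1)) x) ?_
      rw [hbp, hcomm, ← hn, ← Equiv.Perm.mul_apply, ← Equiv.Perm.mul_apply, ← zpow_one_add,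
        ← zpow_add]
      congr 2
      ring
  let Q := Quotient (Equiv.Perm.SameCycle.setoid p)
  let q : X → Q := Quotient.mk _
  have hq {x y : X} : q x = q y ↔ p.SameCycle x y := Quotient.eq
  have hqb (x : X) : q (b x) = q (a x) := by
    rw [hq, hbp, Equiv.Perm.sameCycle_apply_left]
  have hqab (x : X) : q (a (b x)) = q x := by
    rw [← hqb, hb x]
  let r : Q → Q → Prop := WellOrderingRel
  have hflip (x : X) : decide (r (q (a x)) (q x)) = !decide (r (q x) (q (a x))) := by
    rcases trichotomous_of r (q x) (q (a x)) with h | h | h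
    · simp [h, asymm_of r h]
    · exact absurd (hq.1 h) (hne x)
    · simp [h, asymm_of r h]
  refine ⟨fun x => decide (r (q x) (q (a x))), fun x => ⟨?_, ?_⟩⟩
  · simpa only [ha x] using hflip x
  · simpa only [hqb, hqab] using hflip x

namespace RibbonGraph

@[simp]
theorem pdual_empty (G : RibbonGraph) : G.pdual ∅ = G := by
  simp [pdual]

@[simp]
theorem ppetrial_empty (G : RibbonGraph) : G.ppetrial ∅ = G := by
  simp [ppetrial]

/-- The corners of a ribbon graph (edges of its medial graph) can be two-coloured so that every
edge (medial vertex) meets each colour exactly twice. -/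
theorem IsRibbon.exists_balanced_corner_colouring {G : RibbonGraph} (hG : G.IsRibbon) :
    ∃ c : G.flags → Bool, (∀ x, c (G.t1 x) = c x) ∧
      ∀ x, (c (G.t0 x) = c x ∧ c (G.t2 x) = !c x ∧ c (G.t0 (G.t2 x)) = !c x) ∨
        (c (G.t0 x) = !c x ∧ c (G.t2 x) = c x ∧ c (G.t0 (G.t2 x)) = !c x) ∨
        (c (G.t0 x) = !c x ∧ c (G.t2 x) = !c x ∧ c (G.t0 (G.t2 x)) = c x) := by
  obtain ⟨-, i0, i1, i2, hcomm, n0, n1, n2, n02⟩ := hG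
  obtain ⟨o, ho⟩ := exists_bool_flipped_by_involutions i1 i0 n1 n0
  have o1 (x) : o (G.t1 x) = !o x := (ho x).1
  have o0 (x) : o (G.t0 x) = !o x := (ho x).2
  -- `s x` is the other flag of the edge of `x` with the same orientation as `x`
  let s (x : G.flags) : G.flags := if o (G.t2 x) = o x then G.t2 x else G.t0 (G.t2 x)
  have s_pos {x} (h : o (G.t2 x) = o x) : s x = G.t2 x := if_pos h
  have s_neg {x} (h : o (G.t2 x) ≠ o x) : s x = G.t0 (G.t2 x) := if_neg h
  have os (x) : o (s x) = o x := by
    by_cases h : o (G.t2 x) = o x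
    · rw [s_pos h, h]
    · rw [s_neg h, o0]
      exact (Bool.eq_not.2 (Ne.symm h)).symm
  have hs : Function.Involutive s := fun x => by
    by_cases h : o (G.t2 x) = o x
    · rw [s_pos h, s_pos (by rw [i2 x, h]), i2 x]
    · rw [s_neg h, s_neg (by rw [← hcomm, i2 x, o0, o0]; simpa using Ne.symm h),
        ← hcomm, i2 x, i0 x]
  have ns (x) : s x ≠ x := by
    by_cases h : o (G.t2 x) = o x
    · rw [s_pos h]; exact n2 x
    · rw [s_neg h]; exact n02 x
  obtain ⟨d, hd⟩ := exists_bool_flipped_by_involutions i1 hs n1 ns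
  have c1 (x) : (d (G.t1 x) ^^ o (G.t1 x)) = (d x ^^ o x) := by
    rw [(hd x).1, o1, Bool.not_xor_not]
  have cs (x) : (d (s x) ^^ o (s x)) = !(d x ^^ o x) := by
    rw [(hd x).2, os, Bool.not_xor]
  obtain ⟨c, hc⟩ : ∃ c : G.flags → Bool, ∀ x, c x = (d x ^^ o x) := ⟨_, fun _ => rfl⟩
  simp only [← hc] at c1 cs
  refine ⟨c, c1, fun x => ?_⟩
  by_cases h : o (G.t2 x) = o x
  · have h₁ := cs x
    have h₂ := cs (G.t0 x)
    rw [s_pos h] at h₁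
    rw [s_pos (by rw [← hcomm, o0, o0, h]), ← hcomm] at h₂
    rw [h₁, h₂]
    cases c x <;> cases c (G.t0 x) <;> simp
  · have h₁ := cs x
    have h₂ := cs (G.t2 x)
    rw [s_neg h] at h₁
    rw [s_neg (by rw [i2 x]; exact Ne.symm h), i2 x] at h₂
    rw [h₁, h₂]
    cases c x <;> cases c (G.t2 x) <;> simp

end RibbonGraph

open RibbonGraph in
/-- **Theorem 1 (Statement 0).** Every embedded graph has a checkerboard
colourable twisted dual: there is a partition `A₀,…,A₅` of `E(G)` such that
the twisted dual `G^{∏ᵢ ξᵢ(Aᵢ)}`, where `ξ₀,…,ξ₅` are the six elements of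
`⟨δ, τ | δ², τ², (δτ)³⟩`, is checkerboard colourable. -/
theorem exists_checkerboard_twisted_dual (G : RibbonGraph) (hG : G.IsRibbon) :
    ∃ A : Fin 6 → Set G.flags,
      (∀ i, G.IsEdgeSet (A i)) ∧
      (∀ i j, i ≠ j → Disjoint (A i) (A j)) ∧
      (⋃ i, A i) = Set.univ ∧
      (G.twistedDual A).CheckerboardColourable := by
  obtain ⟨c, c1, hc⟩ := hG.exists_balanced_corner_colouring
  obtain ⟨-, i0, -, i2, hcomm, -⟩ := hG
  let S : Set G.flags := {x | c (G.t0 x) = c x}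
  let D : Set G.flags := {x | c (G.t2 x) = c x}
  let T : Set G.flags := {x | c (G.t0 (G.t2 x)) = c x}
  have mS (x) : x ∈ S ↔ c (G.t0 x) = c x := Iff.rfl
  have mD (x) : x ∈ D ↔ c (G.t2 x) = c x := Iff.rfl
  have mT (x) : x ∈ T ↔ c (G.t0 (G.t2 x)) = c x := Iff.rfl
  clear_value S D T
  have eS : G.IsEdgeSet S := fun x hx => by
    rw [mS] at hx
    rcases hc x with h | h | h <;> simp_all [i0 x]
  have eD : G.IsEdgeSet D := fun x hx => by
    rw [mD] at hx
    rw [mD, mD, ← hcomm, i2 x]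
    rcases hc x with h | h | h <;> simp_all
  have eT : G.IsEdgeSet T := fun x hx => by
    rw [mT] at hx
    rw [mT, mT, ← hcomm, i0 (G.t2 x), i2 x]
    rcases hc x with h | h | h <;> simp_all
  have e0 : G.IsEdgeSet ∅ := fun x hx => hx.elim
  have hSD : Disjoint S D := Set.disjoint_left.2 fun x => by
    rcases hc x with h | h | h <;> simp [mS, mD, h]
  have hST : Disjoint S T := Set.disjoint_left.2 fun x => by
    rcases hc x with h | h | h <;> simp [mS, mT, h]
  have hDT : Disjoint D T := Set.disjoint_left.2 fun x => by
    rcases hc x with h | h | h <;> simp [mD, mT, h]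
  refine ⟨![S, D, T, ∅, ∅, ∅], ?_, ?_, ?_, ?_⟩
  · intro i
    fin_cases i <;> assumption
  · intro i j hij
    fin_cases i <;> fin_cases j <;>
      first
        | exact absurd rfl hij
        | exact Set.disjoint_empty _
        | exact Set.empty_disjoint _
        | assumption
        | exact Disjoint.symm ‹_›
  · refine Set.eq_univ_of_forall fun x => Set.mem_iUnion.2 ?_
    rcases hc x with h | h | h
    · exact ⟨0, (mS x).2 h.1⟩
    · exact ⟨1, (mD x).2 h.2.1⟩
    · exact ⟨2, (mT x).2 h.2.2⟩
  · have htd : G.twistedDual ![S, D, T, ∅, ∅, ∅] = (G.pdual D).ppetrial T := by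
      change (((((((((G.pdual D).ppetrial T).pdual ∅).ppetrial ∅).ppetrial ∅).pdual ∅).pdual
        ∅).ppetrial ∅).pdual ∅) = _
      simp only [pdual_empty, ppetrial_empty]
    rw [htd]
    refine ⟨c, fun (x : G.flags) => ⟨?_, c1 x, ?_⟩⟩
    · rcases hc x with h | h | h <;> simp [ppetrial, pdual, mD, mT, i2 x, h]
    · rcases hc x with h | h | h <;> simp [ppetrial, pdual, mD, h]
end

section
/- Every Eulerian embedded graph has a checkerboard colourable partial Petrial; that is, for every Eulerian ribbon graph G there exists a subset I ⊆ E(G) such that G^{τ(I)} is checkerboard colourable. -/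
namespace Equiv.Perm

variable {α : Type*} {a b : Perm α}

theorem apply_mul_zpow_apply (ha : Function.Involutive a) (hb : Function.Involutive b)
    (n : ℤ) (x : α) : a (((b * a) ^ n) x) = ((b * a) ^ (-n)) (a x) := by
  have haa : a * a = 1 := Equiv.ext ha
  have hbb : b * b = 1 := Equiv.ext hb
  have hai : a⁻¹ = a := inv_eq_of_mul_eq_one_left haa
  have hbi : b⁻¹ = b := inv_eq_of_mul_eq_one_left hbb
  have h : SemiconjBy a (b * a) (b * a)⁻¹ := by
    simp [SemiconjBy, hai, hbi, mul_assoc]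
  have h2 := (h.zpow_right n).eq
  rw [inv_zpow'] at h2
  exact congrArg (fun p : Perm α => p x) h2

theorem apply_ne_mul_zpow_apply (ha : Function.Involutive a) (hb : Function.Involutive b)
    (hfa : ∀ x, a x ≠ x) (hfb : ∀ x, b x ≠ x) (k : ℤ) (x : α) :
    a x ≠ ((b * a) ^ k) x := by
  intro h
  obtain ⟨m, rfl | rfl⟩ := Int.even_or_odd' k
  · apply hfa (((b * a) ^ m) x)
    rw [apply_mul_zpow_apply ha hb, h, ← mul_apply, ← zpow_add]
    congr 2
    ring
  · apply hfb (a (((b * a) ^ m) x))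
    rw [← mul_apply b a, ← mul_apply (b * a), ← zpow_one_add]
    rw [apply_mul_zpow_apply ha hb, h, ← mul_apply, ← zpow_add]
    congr 2
    ring

/-- The point obtained from `x` by `n` turns of the rotation `b * a`, followed by `a` when `s`. -/
def dihedralPoint (a b : Perm α) (x : α) (n : ℤ) (s : Bool) : α :=
  bif s then a (((b * a) ^ n) x) else ((b * a) ^ n) x

theorem apply_dihedralPoint (ha : Function.Involutive a) (x : α) (n : ℤ) (s : Bool) :
    a (dihedralPoint a b x n s) = dihedralPoint a b x n (!s) := by
  cases s
  · rfl
  · exact ha _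

theorem apply_dihedralPoint' (hb : Function.Involutive b) (x : α) (n : ℤ) (s : Bool) :
    b (dihedralPoint a b x n s) = dihedralPoint a b x (bif s then 1 + n else -1 + n) (!s) := by
  cases s
  · simp only [dihedralPoint, cond_false, Bool.not_false, cond_true]
    apply hb.injective
    rw [hb, ← mul_apply b a, ← mul_apply (b * a), ← zpow_one_add]
    simp
  · simp only [dihedralPoint, cond_false, Bool.not_true, cond_true]
    rw [← mul_apply b a, ← mul_apply (b * a), ← zpow_one_add]

theorem minimalPeriod_dvd_sub_of_dihedralPoint_eq (ha : Function.Involutive a)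
    (hb : Function.Involutive b) (hfa : ∀ x, a x ≠ x) (hfb : ∀ x, b x ≠ x) {x : α}
    {m n : ℤ} {s t : Bool} (h : dihedralPoint a b x m s = dihedralPoint a b x n t) :
    (Function.minimalPeriod ((b * a) • ·) x : ℤ) ∣ m - n := by
  have aux : ∀ m n : ℤ, ((b * a) ^ m) x = ((b * a) ^ n) x →
      (Function.minimalPeriod ((b * a) • ·) x : ℤ) ∣ m - n := by
    intro m n h
    rw [← MulAction.zpow_smul_eq_iff_minimalPeriod_dvd, Perm.smul_def, sub_eq_neg_add, zpow_add,
      mul_apply, h, ← mul_apply, ← zpow_add]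
    simp
  have aux' : ∀ m n : ℤ, a (((b * a) ^ m) x) ≠ ((b * a) ^ n) x := by
    intro m n h
    apply apply_ne_mul_zpow_apply ha hb hfa hfb (n - m) (((b * a) ^ m) x)
    rw [h, ← mul_apply, ← zpow_add]
    simp
  cases s <;> cases t <;> simp only [dihedralPoint, cond_true, cond_false] at h
  · exact aux _ _ h
  · exact (aux' _ _ h.symm).elim
  · exact (aux' _ _ h).elim
  · exact aux _ _ (a.injective h)

theorem ncard_setOf_dihedralPoint [Finite α] (ha : Function.Involutive a)
    (hb : Function.Involutive b) (hfa : ∀ x, a x ≠ x) (hfb : ∀ x, b x ≠ x) (x : α) :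
    {y | ∃ n s, y = dihedralPoint a b x n s}.ncard =
      2 * Function.minimalPeriod ((b * a) • ·) x := by
  have hmem : ∀ y, y ∈ MulAction.orbit (Subgroup.zpowers (b * a)) x ↔
      ∃ n : ℤ, ((b * a) ^ n) x = y := by
    intro y
    constructor
    · rintro ⟨⟨_, n, rfl⟩, rfl⟩
      exact ⟨n, rfl⟩
    · rintro ⟨n, rfl⟩
      exact ⟨⟨_, n, rfl⟩, rfl⟩
  have hunion : {y | ∃ n s, y = dihedralPoint a b x n s} =
      MulAction.orbit (Subgroup.zpowers (b * a)) x ∪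
        a '' MulAction.orbit (Subgroup.zpowers (b * a)) x := by
    ext y
    simp only [Set.mem_ofPred_eq, Set.mem_union, Set.mem_image, hmem, Bool.exists_bool,
      dihedralPoint, cond_true, cond_false, exists_or, exists_exists_eq_and, eq_comm (a := y)]
  have hdisj : _root_.Disjoint (MulAction.orbit (Subgroup.zpowers (b * a)) x)
      (a '' MulAction.orbit (Subgroup.zpowers (b * a)) x) := by
    rw [Set.disjoint_left]
    rintro y hy ⟨z, hz, rfl⟩
    obtain ⟨n, hn⟩ := (hmem _).1 hy
    obtain ⟨m, rfl⟩ := (hmem _).1 hz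
    apply apply_ne_mul_zpow_apply ha hb hfa hfb (n - m) (((b * a) ^ m) x)
    rw [← hn, ← mul_apply, ← zpow_add]
    simp
  have := Fintype.ofFinite (MulAction.orbit (Subgroup.zpowers (b * a)) x)
  rw [hunion, Set.ncard_union_eq hdisj (Set.toFinite _) (Set.toFinite _),
    Set.ncard_image_of_injective _ a.injective, MulAction.minimalPeriod_eq_card,
    ← Nat.card_eq_fintype_card, Nat.card_coe_set_eq, two_mul]

end Equiv.Perm

namespace RibbonGraph

open Equiv.Perm

theorem sameVertex_symm {G : RibbonGraph} (h1 : Function.Involutive G.t1)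
    (h2 : Function.Involutive G.t2) {x y : G.flags} (h : G.sameVertex x y) :
    G.sameVertex y x := by
  have : Std.Symm fun u v => G.t1 u = v ∨ G.t2 u = v := by
    refine ⟨?_⟩
    rintro u v (rfl | rfl)
    · exact Or.inl (h1 u)
    · exact Or.inr (h2 u)
  exact Relation.ReflTransGen.stdSymm.symm _ _ h

theorem sameVertex_iff_exists_dihedralPoint {G : RibbonGraph} (h1 : Function.Involutive G.t1)
    (h2 : Function.Involutive G.t2) {x y : G.flags} :
    G.sameVertex x y ↔ ∃ n s, y = dihedralPoint h1.toPerm h2.toPerm x n s := by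
  constructor
  · intro h
    induction h with
    | refl => exact ⟨0, false, rfl⟩
    | tail _ hstep ih =>
      obtain ⟨n, s, rfl⟩ := ih
      rcases hstep with rfl | rfl
      · exact ⟨_, _, apply_dihedralPoint (a := h1.toPerm) h1 x n s⟩
      · exact ⟨_, _, apply_dihedralPoint' (b := h2.toPerm) h2 x n s⟩
  · rintro ⟨n, s, rfl⟩
    have hrot : G.sameVertex x (((h2.toPerm * h1.toPerm) ^ n) x) := by
      induction n with
      | zero => exact Relation.ReflTransGen.refl
      | succ n ih =>
        rw [add_comm, zpow_one_add]
        exact (ih.tail (Or.inl rfl)).tail (Or.inr rfl)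
      | pred n ih =>
        rw [sub_eq_neg_add, zpow_add, zpow_neg_one]
        exact (ih.tail (Or.inr rfl)).tail (Or.inl rfl)
    cases s
    · exact hrot
    · exact hrot.tail (Or.inl rfl)

/-- In an Eulerian ribbon graph the flags admit a 2-colouring that is constant on corners and
changes across each half-edge. -/
theorem Eulerian.exists_colouring {G : RibbonGraph} (hG : G.IsRibbon) (hE : G.Eulerian) :
    ∃ c : G.flags → Bool, ∀ x, c (G.t1 x) = c x ∧ c (G.t2 x) = !c x := by
  classical
  obtain ⟨hfin, -, h1, h2, -, -, hf1, hf2, -⟩ := hG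
  have hperiod (x : G.flags) :
      Even (Function.minimalPeriod ((h2.toPerm * h1.toPerm) • ·) x) := by
    have h := hE x
    have hset : {y | G.sameVertex x y} =
        {y | ∃ n s, y = dihedralPoint h1.toPerm h2.toPerm x n s} :=
      Set.ext fun y => sameVertex_iff_exists_dihedralPoint h1 h2
    rwa [degree, hset, ncard_setOf_dihedralPoint h1 h2 hf1 hf2,
      Nat.mul_div_cancel_left _ two_pos] at h
  let S : Setoid G.flags :=
    ⟨G.sameVertex, fun _ => .refl, sameVertex_symm h1 h2, Relation.ReflTransGen.trans⟩
  let rep (y : G.flags) : G.flags := (Quotient.mk S y).out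
  have hrep (y : G.flags) : G.sameVertex (rep y) y := Quotient.mk_out (s := S) y
  have hrep1 (y : G.flags) : rep (G.t1 y) = rep y :=
    congrArg Quotient.out (Quotient.sound (s := S)
      (sameVertex_symm h1 h2 (.single (Or.inl rfl))))
  have hrep2 (y : G.flags) : rep (G.t2 y) = rep y :=
    congrArg Quotient.out (Quotient.sound (s := S)
      (sameVertex_symm h1 h2 (.single (Or.inr rfl))))
  let c (y : G.flags) : Bool :=
    decide (∃ n s, Even n ∧ y = dihedralPoint h1.toPerm h2.toPerm (rep y) n s)
  have hc {y : G.flags} {n : ℤ} {s : Bool}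
      (hy : y = dihedralPoint h1.toPerm h2.toPerm (rep y) n s) : c y = decide (Even n) := by
    refine decide_eq_decide.2 ⟨?_, fun hn => ⟨n, s, hn, hy⟩⟩
    rintro ⟨m, t, hm, hy'⟩
    have hdvd := minimalPeriod_dvd_sub_of_dihedralPoint_eq (a := h1.toPerm) (b := h2.toPerm)
      h1 h2 hf1 hf2 (hy'.symm.trans hy)
    have heven : Even (m - n) :=
      even_iff_two_dvd.2 ((even_iff_two_dvd.1 ((Int.even_coe_nat _).2 (hperiod _))).trans hdvd)
    exact (Int.even_sub.1 heven).1 hm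
  refine ⟨c, fun y => ?_⟩
  obtain ⟨n, s, hy⟩ := (sameVertex_iff_exists_dihedralPoint h1 h2).1 (hrep y)
  have hy1 := (congrArg G.t1 hy).trans (apply_dihedralPoint (a := h1.toPerm) h1 _ n s)
  have hy2 := (congrArg G.t2 hy).trans (apply_dihedralPoint' (b := h2.toPerm) h2 _ n s)
  rw [← hrep1 y] at hy1
  rw [← hrep2 y] at hy2
  rw [hc hy, hc hy1, hc hy2]
  refine ⟨rfl, ?_⟩
  cases s <;> simp [Int.even_add, ← decide_not]

end RibbonGraph

open RibbonGraph in
/-- **Theorem 2 (Statement 1).** Every Eulerian embedded graph has a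
checkerboard colourable partial Petrial. -/
theorem eulerian_exists_checkerboard_partial_petrial (G : RibbonGraph)
    (hG : G.IsRibbon) (hE : G.Eulerian) :
    ∃ I : Set G.flags, G.IsEdgeSet I ∧ (G.ppetrial I).CheckerboardColourable := by
  obtain ⟨c, hc⟩ := hE.exists_colouring hG
  obtain ⟨-, h0, -, -, h02, -⟩ := hG
  refine ⟨{x | c (G.t0 x) ≠ c x}, fun x hx => ⟨?_, ?_⟩, c, fun x => ⟨?_, hc x⟩⟩
  · simpa [h0 x] using Ne.symm hx
  · simpa [h02, (hc _).2] using hx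
  · by_cases h : c (G.t0 x) = c x
    · simp [ppetrial, h]
    · have h' : c (G.t0 (G.t2 x)) = c x := by
        rw [h02 x, (hc _).2, Bool.not_eq]
        exact h
      simp [ppetrial, h, h']
end

section
/- Let G be an embedded graph. If the Petrial G^× of G is orientable, then the geometric dual G* of G is an Eulerian graph. -/
namespace RibbonGraph

/-- A finite set stable under a fixed-point-free involution has even cardinality. -/
theorem even_card_of_involutive {α : Type*} (s : Finset α) (f : α → α)
    (hf : Function.Involutive f) (hne : ∀ x, f x ≠ x) (hs : ∀ x ∈ s, f x ∈ s) :
    Even s.card := by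
  have h : ∑ _x ∈ s, (1 : ZMod 2) = 0 :=
    Finset.sum_involution (fun x _ => f x) (fun _ _ => by decide) (fun x _ _ => hne x)
      hs (fun x _ => hf x)
  rw [Finset.sum_const, nsmul_one] at h
  exact (ZMod.natCast_eq_zero_iff_even).mp h

/-- If `f` preserves and `g` flips a two-colouring of a finite set, and both are involutions of
the set with `f` fixed-point-free, then half the size of the set is even. -/
theorem even_half_card_of_colouring {α : Type*} (s : Finset α) (f g : α → α) (c : α → Bool)
    (hf : Function.Involutive f) (hne : ∀ x, f x ≠ x) (hg : Function.Involutive g)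
    (hfs : ∀ x ∈ s, f x ∈ s) (hgs : ∀ x ∈ s, g x ∈ s)
    (hcf : ∀ x, c (f x) = c x) (hcg : ∀ x, c (g x) = !c x) :
    Even (s.card / 2) := by
  have heq : (s.filter (c · = true)).card = (s.filter (¬ c · = true)).card :=
    Finset.card_bij' (fun x _ => g x) (fun x _ => g x) (by simp +contextual [hgs, hcg])
      (by simp +contextual [hgs, hcg]) (fun x _ => hg x) (fun x _ => hg x)
  have hadd := s.card_filter_add_card_filter_not (c · = true)
  have heven := even_card_of_involutive (s.filter (c · = true)) f hf hne
    (by simp +contextual [hfs, hcf])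
  have hhalf : s.card / 2 = (s.filter (c · = true)).card := by omega
  rwa [hhalf]

/-- A finite flag system is Eulerian if its flags have a two-colouring that is flipped by `t1` and
preserved by the fixed-point-free involution `t2`. -/
theorem eulerian_of_colouring (G : RibbonGraph) (hfin : Finite G.flags)
    (h1 : Function.Involutive G.t1) (h2 : Function.Involutive G.t2) (hne : ∀ x, G.t2 x ≠ x)
    (c : G.flags → Bool) (hc1 : ∀ x, c (G.t1 x) = !c x) (hc2 : ∀ x, c (G.t2 x) = c x) :
    G.Eulerian := by
  intro x
  have hs := Set.toFinite {y | G.sameVertex x y}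
  rw [degree, Set.ncard_eq_toFinset_card _ hs]
  refine even_half_card_of_colouring hs.toFinset G.t2 G.t1 c h2 hne h1 ?_ ?_ hc2 hc1
  · intro y hy
    rw [Set.Finite.mem_toFinset] at hy ⊢
    exact Relation.ReflTransGen.tail hy (Or.inr rfl)
  · intro y hy
    rw [Set.Finite.mem_toFinset] at hy ⊢
    exact Relation.ReflTransGen.tail hy (Or.inl rfl)

theorem gdual_t2 (G : RibbonGraph) : G.gdual.t2 = G.t0 := by
  funext x
  exact if_pos (Set.mem_univ x)

theorem petrial_t0 (G : RibbonGraph) (x : G.flags) : G.petrial.t0 x = G.t0 (G.t2 x) :=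
  if_pos (Set.mem_univ x)

end RibbonGraph

open RibbonGraph in
/-- **Theorem 3 (Statement 2).** If the Petrial `G^×` of an embedded graph `G`
is orientable, then the geometric dual `G*` is Eulerian. -/
theorem gdual_eulerian_of_petrial_orientable (G : RibbonGraph)
    (hG : G.IsRibbon) (h : G.petrial.Orientable) :
    G.gdual.Eulerian := by
  obtain ⟨hfin, h0, h1, h2, -, hne, -⟩ := hG
  obtain ⟨c, hc⟩ := h
  have hc0 (x : G.flags) : c (G.t0 x) = c x := by
    have hx : c (G.t0 (G.t2 (G.t2 x))) = !c (G.t2 x) :=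
      (congrArg c (petrial_t0 G (G.t2 x))).symm.trans (hc (G.t2 x)).1
    have hx2 : c (G.t2 x) = !c x := (hc x).2.2
    rwa [h2 x, hx2, Bool.not_not] at hx
  refine eulerian_of_colouring G.gdual hfin h1 ?_ ?_ c (fun x => (hc x).2.1) ?_ <;>
    rw [gdual_t2]
  exacts [h0, hne, hc0]
end

section
/- Let G be an oriented ribbon graph with a fixed orientation and let A ⊆ E(G). Then there exists an orientation of every boundary component of G − A such that, for every edge e ∈ A^c, one of the two edge-line segments of e is positive and the other is negative, and for every edge f ∈ A, one of the two common line segments of f is positive and the other is negative, if and only if the partial dual G^A is checkerboard colourable. -/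
open Classical in
theorem RibbonGraph.pdual_checkerboardColourable_iff (G : RibbonGraph) (A : Set G.flags) :
    (G.pdual A).CheckerboardColourable ↔ ∃ c : G.flags → Bool, ∀ x : G.flags,
      c (if x ∈ A then G.t2 x else G.t0 x) = c x ∧ c (G.t1 x) = c x ∧
        c (if x ∈ A then G.t0 x else G.t2 x) = !c x :=
  Iff.rfl

open RibbonGraph in
/-- **Lemma (Statement 4).** Let `G` be an oriented ribbon graph with a fixed
orientation `o` and let `A ⊆ E(G)`.  There is an orientation `b` of all the
boundary components of `G − A` (a colouring of the flags that is consistent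
along the corners, along the edge-line segments of the edges of `Aᶜ`, and
along the common line segments of the edges of `A`) such that for each
`e ∈ Aᶜ` one of the two edge-line segments of `e` is positive (the boundary
orientation agrees with `o` there) and the other is negative, and for each
`f ∈ A` one of the two common line segments of `f` is positive and the other
is negative, if and only if the partial dual `G^A` is checkerboard
colourable. -/
theorem boundary_orientation_iff_pdual_checkerboard (G : RibbonGraph)
    (hG : G.IsRibbon) (o : G.flags → Bool)
    (ho : ∀ x, o (G.t0 x) = !o x ∧ o (G.t1 x) = !o x ∧ o (G.t2 x) = !o x)
    (A : Set G.flags) (hA : G.IsEdgeSet A) :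
    (∃ b : G.flags → Bool,
        (∀ x, b (G.t1 x) = !b x) ∧
        (∀ x ∈ A, b (G.t2 x) = !b x) ∧
        (∀ x ∉ A, b (G.t0 x) = !b x) ∧
        (∀ x ∉ A, ((b x = o x) ↔ ¬(b (G.t2 x) = o (G.t2 x)))) ∧
        (∀ x ∈ A, ((b x = o x) ↔ ¬(b (G.t0 x) = o (G.t0 x)))))
      ↔ (G.pdual A).CheckerboardColourable := by
  rw [pdual_checkerboardColourable_iff]
  constructor
  · rintro ⟨b, h1, h2, h0, h3, h4⟩
    refine ⟨fun x => b x ^^ o x, fun x => ?_⟩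
    obtain ⟨o0, o1, o2⟩ := ho x
    have b1 := h1 x
    by_cases hx : x ∈ A
    · have b2 := h2 x hx
      have b0 := h4 x hx
      simp only [hx, if_true, o0, o1, o2, b1, b2] at b0 ⊢
      revert b0
      cases b x <;> cases o x <;> cases b (G.t0 x) <;> simp
    · have b0 := h0 x hx
      have b2 := h3 x hx
      simp only [hx, if_false, o0, o1, o2, b0, b1] at b2 ⊢
      revert b2
      cases b x <;> cases o x <;> cases b (G.t2 x) <;> simp
  · rintro ⟨c, hc⟩
    refine ⟨fun x => c x ^^ o x, fun x => ?_, fun x hx => ?_, fun x hx => ?_,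
      fun x hx => ?_, fun x hx => ?_⟩ <;>
    obtain ⟨o0, o1, o2⟩ := ho x <;>
    obtain ⟨c0, c1, c2⟩ := hc x
    · simp [o1, c1]
    all_goals
      simp only [hx, if_true, if_false] at c0 c2
      simp only [o0, o2, c0, c2]
      cases c x <;> cases o x <;> simp
end

section
/- Let G be an embedded graph and let D be the set of d-edges of G arising from an all-crossing direction of the medial graph G_m. Then G − D and G* − D^c are both Eulerian, where D^c = E(G) \ D. -/
namespace RibbonGraph

/-- A graph is Eulerian as soon as its flags carry a two-colouring that is reversed by the corner
map and preserved by the fixed-point-free involution `t2`. -/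
theorem eulerian_of_coloring (K : RibbonGraph) [Finite K.flags] (o : K.flags → Bool)
    (h1 : Function.Injective K.t1) (h2 : Function.Involutive K.t2) (hfix : ∀ x, K.t2 x ≠ x)
    (ho1 : ∀ x, o (K.t1 x) = !o x) (ho2 : ∀ x, o (K.t2 x) = o x) : K.Eulerian := by
  classical
  have := Fintype.ofFinite K.flags
  intro x
  set S : Finset K.flags := {y | K.sameVertex x y} with hS
  have hS1 : ∀ y ∈ S, K.t1 y ∈ S := fun y hy => by
    simp only [hS, Finset.mem_filter, Finset.mem_univ, true_and] at hy ⊢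
    exact hy.tail (Or.inl rfl)
  have hS2 : ∀ y ∈ S, K.t2 y ∈ S := fun y hy => by
    simp only [hS, Finset.mem_filter, Finset.mem_univ, true_and] at hy ⊢
    exact hy.tail (Or.inr rfl)
  have hle : ∀ b : Bool, (S.filter (o · = b)).card ≤ (S.filter (o · = !b)).card := fun b =>
    Finset.card_le_card_of_injOn K.t1
      (fun y hy => by
        simp only [Finset.coe_filter, Set.mem_ofPred_eq] at hy ⊢
        exact ⟨hS1 y hy.1, by rw [ho1, hy.2]⟩)
      h1.injOn
  have heven : Even (S.filter (o · = true)).card := by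
    have hsum : ∑ _y ∈ S.filter (o · = true), (1 : ZMod 2) = 0 := by
      refine Finset.sum_involution (fun y _ => K.t2 y) (fun _ _ => by decide)
        (fun y _ _ => hfix y) (fun y hy => ?_) (fun y _ => h2 y)
      simp only [Finset.mem_filter] at hy ⊢
      exact ⟨hS2 y hy.1, by rw [ho2, hy.2]⟩
    rw [Finset.sum_const, nsmul_one] at hsum
    exact (ZMod.natCast_eq_zero_iff_even).1 hsum
  have hcard : (S.filter (o · = true)).card + (S.filter (o · = false)).card = S.card := by
    simpa using Finset.card_filter_add_card_filter_not (s := S) (o · = true)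
  have hle_true := hle true
  have hle_false := hle false
  simp only [Bool.not_true, Bool.not_false] at hle_true hle_false
  have hdeg : K.degree x = S.card / 2 := by
    rw [degree, ← Set.ncard_coe_finset, hS]
    simp
  rw [hdeg]
  obtain ⟨m, hm⟩ := heven
  exact ⟨m, by omega⟩

/-- With enough fuel, `delSkip` stops at the first surviving flag. -/
theorem delSkip_eq_iterate (H : RibbonGraph) (A : Set H.flags) (N : ℕ) :
    ∀ (k : ℕ) (y : H.flags), k ≤ N → (fun z => H.t1 (H.t2 z))^[k] y ∉ A →
      ∃ n, H.delSkip A N y = (fun z => H.t1 (H.t2 z))^[n] y ∧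
        H.delSkip A N y ∉ A ∧ ∀ i < n, (fun z => H.t1 (H.t2 z))^[i] y ∈ A := by
  induction N with
  | zero =>
    intro k y hk hy
    obtain rfl : k = 0 := by omega
    exact ⟨0, rfl, hy, by simp⟩
  | succ N ih =>
    intro k y hk hy
    by_cases hA : y ∈ A
    · obtain _ | k := k
      · exact absurd hA hy
      obtain ⟨n, hn, hnA, hlt⟩ := ih k (H.t1 (H.t2 y)) (by omega) hy
      rw [delSkip, if_pos hA]
      refine ⟨n + 1, hn, hnA, fun i hi => ?_⟩
      obtain _ | i := i
      · exact hA
      · exact hlt i (by omega)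
    · rw [delSkip, if_neg hA]
      exact ⟨0, rfl, hA, by simp⟩

/-- Starting at the corner of a surviving flag, `delSkip` reaches a surviving flag. -/
theorem delSkip_t1 (H : RibbonGraph) [Finite H.flags] (A : Set H.flags)
    (h1 : Function.Involutive H.t1) (h2 : Function.Involutive H.t2)
    (hA : ∀ x ∉ A, H.t2 x ∉ A) {x : H.flags} (hx : x ∉ A) :
    ∃ n, H.delSkip A (Nat.card H.flags + 1) (H.t1 x) = (fun z => H.t1 (H.t2 z))^[n] (H.t1 x) ∧
      H.delSkip A (Nat.card H.flags + 1) (H.t1 x) ∉ A ∧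
        ∀ i < n, (fun z => H.t1 (H.t2 z))^[i] (H.t1 x) ∈ A := by
  have := Fintype.ofFinite H.flags
  set g : H.flags → H.flags := fun z => H.t1 (H.t2 z) with hg
  have hinj : Function.Injective g := h1.injective.comp h2.injective
  have hper : H.t1 x ∈ Function.periodicPts g := hinj.mem_periodicPts _
  have hpos := Function.minimalPeriod_pos_of_mem_periodicPts hper
  refine H.delSkip_eq_iterate A _ (Function.minimalPeriod g (H.t1 x) - 1) _ ?_ ?_
  · have : Function.minimalPeriod g (H.t1 x) ≤ Nat.card H.flags := by
      rw [Nat.card_eq_fintype_card]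
      exact Function.minimalPeriod_le_card
    omega
  · have hback : g (g^[Function.minimalPeriod g (H.t1 x) - 1] (H.t1 x)) = g (H.t2 x) := by
      rw [← Function.iterate_succ_apply' g, Nat.succ_eq_add_one, Nat.sub_add_cancel hpos,
        Function.iterate_minimalPeriod, hg]
      simp only [h2 x]
    change g^[Function.minimalPeriod g (H.t1 x) - 1] (H.t1 x) ∉ A
    rw [hinj hback]
    exact hA x hx

/-- If a two-colouring of the flags is reversed by `t1`, then deleting the edges whose flags change
colour under `t2` leaves an Eulerian graph. -/
theorem eulerian_del (H : RibbonGraph) [Finite H.flags] (A : Set H.flags) (o : H.flags → Bool)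
    (h1 : Function.Involutive H.t1) (h2 : Function.Involutive H.t2) (hfix : ∀ x, H.t2 x ≠ x)
    (ho1 : ∀ x, o (H.t1 x) = !o x) (hA : ∀ x, x ∉ A ↔ o (H.t2 x) = o x) :
    (H.del A).Eulerian := by
  have hA2 : ∀ x ∉ A, H.t2 x ∉ A := fun x hx => by
    rw [hA, h2 x]
    exact ((hA x).1 hx).symm
  have hflip : ∀ x ∈ A, o (H.t1 (H.t2 x)) = o x := fun x hx => by
    have := mt (hA x).2 (not_not.2 hx)
    rw [ho1]
    revert this
    cases o (H.t2 x) <;> cases o x <;> simp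
  have hiter : ∀ (n : ℕ) (y : H.flags), (∀ i < n, (fun z => H.t1 (H.t2 z))^[i] y ∈ A) →
      o ((fun z => H.t1 (H.t2 z))^[n] y) = o y := by
    intro n y
    induction n with
    | zero => simp
    | succ n ih =>
      intro h
      rw [Function.iterate_succ_apply', hflip _ (h n n.lt_succ_self)]
      exact ih fun i hi => h i (by omega)
  have hfirst : ∀ (x x' : H.flags) (n m : ℕ), x ∉ A →
      (∀ i < m, (fun z => H.t1 (H.t2 z))^[i] (H.t1 x') ∈ A) → n ≤ m →
      (fun z => H.t1 (H.t2 z))^[n] (H.t1 x) = (fun z => H.t1 (H.t2 z))^[m] (H.t1 x') →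
      x = x' := by
    intro x x' n m hx hm hnm heq
    obtain ⟨k, rfl⟩ := Nat.exists_eq_add_of_le hnm
    rw [Function.iterate_add_apply] at heq
    have hk := (h1.injective.comp h2.injective).iterate n heq
    obtain _ | k := k
    · exact h1.injective hk
    · rw [Function.iterate_succ_apply'] at hk
      have hmem := hm k (by omega)
      rw [← h2 ((fun z => H.t1 (H.t2 z))^[k] (H.t1 x')), ← h1.injective hk] at hmem
      exact absurd hmem (hA2 x hx)
  have ht1 : ∀ x : (H.del A).flags,
      ((H.del A).t1 x).1 = H.delSkip A (Nat.card H.flags + 1) (H.t1 x.1) := fun x => by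
    obtain ⟨n, -, hn, -⟩ := H.delSkip_t1 A h1 h2 hA2 x.2
    exact congrArg Subtype.val (dif_pos hn)
  have ht2 : ∀ x : (H.del A).flags, ((H.del A).t2 x).1 = H.t2 x.1 := fun x =>
    congrArg Subtype.val (dif_pos (hA2 x.1 x.2))
  have : Finite (H.del A).flags := inferInstanceAs (Finite {x : H.flags // x ∉ A})
  refine (H.del A).eulerian_of_coloring (fun x => o x.1) ?_ ?_ ?_ ?_ ?_
  · intro x x' hxx'
    have heq := congrArg Subtype.val hxx'
    rw [ht1, ht1] at heq
    obtain ⟨n, hn, -, hnA⟩ := H.delSkip_t1 A h1 h2 hA2 x.2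
    obtain ⟨m, hm, -, hmA⟩ := H.delSkip_t1 A h1 h2 hA2 x'.2
    rw [hn, hm] at heq
    refine Subtype.ext ?_
    rcases le_total n m with h | h
    · exact hfirst _ _ n m x.2 hmA h heq
    · exact (hfirst _ _ m n x'.2 hnA h heq.symm).symm
  · intro x
    exact Subtype.ext (by rw [ht2, ht2, h2 x.1])
  · intro x hx
    exact hfix x.1 (by rw [← ht2, hx])
  · intro x
    obtain ⟨n, hn, -, hnA⟩ := H.delSkip_t1 A h1 h2 hA2 x.2
    rw [ht1, hn, hiter n _ hnA, ho1]
  · intro x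
    rw [ht2]
    exact (hA x.1).1 x.2

end RibbonGraph

open RibbonGraph in
/-- **Lemma (Statement 5).** If `D` is the set of `d`-edges of an embedded
graph `G` arising from an all-crossing direction of the medial graph `G_m`,
then `G − D` and `G* − Dᶜ` are both Eulerian. -/
theorem del_dEdges_eulerian (G : RibbonGraph) (hG : G.IsRibbon)
    (o : G.flags → Bool) (ho : G.IsAllCrossing o) :
    (G.del (G.dEdges o)).Eulerian ∧ (G.gdual.del (G.dEdges o)ᶜ).Eulerian := by
  obtain ⟨hfin, h0, h1, h2, hcomm, hf0, -, hf2, -⟩ := hG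
  obtain ⟨ho1, ho02⟩ := ho
  have ht2 : G.gdual.t2 = G.t0 := funext fun x => if_pos (Set.mem_univ x)
  constructor
  · refine G.eulerian_del _ o h1 h2 hf2 ho1 fun x => ?_
    have h := ho02 (G.t0 x)
    rw [hcomm, h0] at h
    change ¬ o (G.t0 x) = o x ↔ _
    rw [h]
    cases o (G.t0 x) <;> cases o x <;> simp
  · have : Finite G.gdual.flags := hfin
    refine G.gdual.eulerian_del _ o h1 (by rw [ht2]; exact h0) (by rw [ht2]; exact hf0) ho1
      fun x => ?_
    rw [ht2]
    exact not_not
end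

section
/- Let G be an embedded graph, A, B, C ⊆ E(G) with B ∩ C = ∅. Then (G − B/C)^A = G^A − B'/C', where B' = (B ∩ A^c) ∪ (C ∩ A) and C' = (C ∩ A^c) ∪ (B ∩ A). -/
namespace RibbonGraph

open Classical

theorem Iso.of_eq {G H : RibbonGraph} (h : G = H) : G.Iso H := by
  subst h
  exact ⟨Equiv.refl _, fun _ => rfl, fun _ => rfl, fun _ => rfl⟩

theorem ite_ite_eq_ite_symmDiff {α β : Type*} (A B : Set α) (x : α) (s t : β) :
    (if x ∈ B then (if x ∈ A then s else t) else if x ∈ A then t else s) =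
      if x ∈ symmDiff A B then t else s := by
  by_cases hA : x ∈ A <;> by_cases hB : x ∈ B <;> simp [Set.mem_symmDiff, hA, hB]

/-- Partial duals compose by symmetric difference of the edge sets, also under deletion. -/
theorem del_pdual_pdual (G : RibbonGraph) (A B D : Set G.flags) :
    RibbonGraph.del ((G.pdual A).pdual B) D = (G.pdual (symmDiff A B)).del D := by
  have t0_eq : ((G.pdual A).pdual B).t0 = (G.pdual (symmDiff A B)).t0 :=
    funext fun x => ite_ite_eq_ite_symmDiff A B x (G.t0 x) (G.t2 x)
  have t2_eq : ((G.pdual A).pdual B).t2 = (G.pdual (symmDiff A B)).t2 :=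
    funext fun x => ite_ite_eq_ite_symmDiff A B x (G.t2 x) (G.t0 x)
  change RibbonGraph.del ⟨G.flags, ((G.pdual A).pdual B).t0, G.t1, ((G.pdual A).pdual B).t2⟩ D = _
  rw [t0_eq, t2_eq]
  rfl

/-- Skipping over the edges of `D` only uses the values of `t2` on `D`. -/
theorem delSkip_congr {F : Type} {t0 t0' t1 t2 t2' : F → F} {D : Set F}
    (h : ∀ y ∈ D, t2 y = t2' y) (n : ℕ) (y : F) :
    (RibbonGraph.mk F t0 t1 t2).delSkip D n y = (RibbonGraph.mk F t0' t1 t2').delSkip D n y := by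
  induction n generalizing y with
  | zero => rfl
  | succ n ih =>
    simp only [delSkip]
    split_ifs with hy
    · rw [h y hy]
      exact ih _
    · rfl

theorem ite_apply_ite_eq {α β γ : Type*} {A C S : Set α} {x : α} (hC : x ∉ C)
    (hS : x ∈ S ↔ x ∈ A) (r : β → γ) (s t : β) :
    (if x ∈ A then r (if x ∈ C then s else t) else r (if x ∈ C then t else s)) =
      r (if x ∈ S then t else s) := by
  by_cases hA : x ∈ A <;> simp [hA, hS, hC]

/-- Partial duality after deleting `D` amounts to partial duality, before deleting `D`,
of the remaining edges. -/
theorem pdual_del_pdual (G : RibbonGraph) {A C D S : Set G.flags} (hCD : C ⊆ D)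
    (hS : S = A \ D ∪ C) :
    ((G.pdual C).del D).pdual (Subtype.val ⁻¹' A) = (G.pdual S).del D := by
  have agree (y : G.flags) (hy : y ∈ D) : (if y ∈ C then G.t0 y else G.t2 y) =
      if y ∈ S then G.t0 y else G.t2 y := by
    simp [hS, hy]
  have skip : (G.pdual C).delSkip D (Nat.card G.flags + 1) =
      (G.pdual S).delSkip D (Nat.card G.flags + 1) :=
    funext fun y => delSkip_congr agree _ y
  have t1_eq : ((G.pdual C).del D).t1 = ((G.pdual S).del D).t1 :=
    congrArg (fun (f : G.flags → G.flags) (x : {x : G.flags // x ∉ D}) =>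
      if h : f (G.t1 x.1) ∉ D then (⟨f (G.t1 x.1), h⟩ : {x : G.flags // x ∉ D}) else x) skip
  have hC (x : {x : G.flags // x ∉ D}) : x.1 ∉ C := fun h => x.2 (hCD h)
  have mem_iff (x : {x : G.flags // x ∉ D}) : x.1 ∈ S ↔ x.1 ∈ A := by
    simp [hS, hC x, x.2]
  let restrict (x : {x : G.flags // x ∉ D}) (y : G.flags) : {x : G.flags // x ∉ D} :=
    if h : y ∉ D then ⟨y, h⟩ else x
  have t0_eq : (((G.pdual C).del D).pdual (Subtype.val ⁻¹' A)).t0 =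
      ((G.pdual S).del D).t0 :=
    funext fun x => ite_apply_ite_eq (hC x) (mem_iff x) (restrict x) (G.t0 x.1) (G.t2 x.1)
  have t2_eq : (((G.pdual C).del D).pdual (Subtype.val ⁻¹' A)).t2 =
      ((G.pdual S).del D).t2 :=
    funext fun x => ite_apply_ite_eq (hC x) (mem_iff x) (restrict x) (G.t2 x.1) (G.t0 x.1)
  change RibbonGraph.mk {x : G.flags // x ∉ D} (((G.pdual C).del D).pdual (Subtype.val ⁻¹' A)).t0
    ((G.pdual C).del D).t1 (((G.pdual C).del D).pdual (Subtype.val ⁻¹' A)).t2 = _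
  rw [t0_eq, t1_eq, t2_eq]
  rfl

end RibbonGraph
open RibbonGraph in
/-- **Lemma (Statement 6).** For any embedded graph `G` and `A, B, C ⊆ E(G)`
with `B ∩ C = ∅`, one has `(G − B/C)^A = G^A − B'/C'` where
`B' = (B ∩ Aᶜ) ∪ (C ∩ A)` and `C' = (C ∩ Aᶜ) ∪ (B ∩ A)`
(and `(G − B/C)^A` means the partial dual with respect to `A ∩ E(G − B/C)`). -/
theorem delContract_pdual (G : RibbonGraph) (hG : G.IsRibbon)
    (A B C : Set G.flags) (hA : G.IsEdgeSet A) (hB : G.IsEdgeSet B)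
    (hC : G.IsEdgeSet C) (hBC : B ∩ C = ∅) :
    RibbonGraph.Iso
      ((G.delContract B C).pdual (Subtype.val ⁻¹' A))
      ((G.pdual A).delContract ((B ∩ Aᶜ) ∪ (C ∩ A)) ((C ∩ Aᶜ) ∪ (B ∩ A))) := by
  have hD : (B ∩ Aᶜ ∪ C ∩ A) ∪ (C ∩ Aᶜ ∪ B ∩ A) = B ∪ C := by
    ext x; simp; tauto
  have hS : symmDiff A (C ∩ Aᶜ ∪ B ∩ A) = A \ (B ∪ C) ∪ C := by
    ext x
    have hx : ¬ (x ∈ B ∧ x ∈ C) := fun h => (hBC ▸ h : x ∈ (∅ : Set G.flags))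
    simp [Set.mem_symmDiff]
    tauto
  apply Iso.of_eq
  refine (G.pdual_del_pdual Set.subset_union_right hS).trans ?_
  rw [← hD]
  exact (G.del_pdual_pdual _ _ _).symm
end

section
/- Let G be an embedded graph and A ⊆ E(G). If the partial dual G^A is bipartite, then (G − A^c)* and (G* − A)* are both bipartite, where A^c = E(G) \ A. -/
namespace RibbonGraph

/-- Skipping over deleted edges preserves every colouring that is constant on corners and on the
two sides of each deleted edge. -/
theorem delSkip_colour (G : RibbonGraph) (B : Set G.flags) (c : G.flags → Bool)
    (h1 : ∀ x, c (G.t1 x) = c x) (h2 : ∀ x ∈ B, c (G.t2 x) = c x) (n : ℕ) (y : G.flags) :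
    c (G.delSkip B n y) = c y := by
  induction n generalizing y with
  | zero => rfl
  | succ n ih =>
    rw [delSkip]
    split_ifs with hy
    · rw [ih, h1, h2 y hy]
    · rfl

/-- A colouring that is constant on corners, constant on the two sides of each edge of `B`, and
a checkerboard colouring away from `B`, restricts to a proper colouring of `(G − B)*`. -/
theorem bipartite_gdual_del (G : RibbonGraph) (B : Set G.flags) (c : G.flags → Bool)
    (hB0 : ∀ x ∉ B, G.t0 x ∉ B) (hB2 : ∀ x ∉ B, G.t2 x ∉ B)
    (h1 : ∀ x, c (G.t1 x) = c x) (h2 : ∀ x ∈ B, c (G.t2 x) = c x)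
    (h0' : ∀ x ∉ B, c (G.t0 x) = c x) (h2' : ∀ x ∉ B, c (G.t2 x) = !c x) :
    ((G.del B).gdual).Bipartite := by
  refine ⟨fun x : {x : G.flags // x ∉ B} => c x.1, ?_⟩
  rintro ⟨x, hx⟩
  refine ⟨?_, ?_, ?_⟩
  · simp [gdual, pdual, del, hB2 x hx, h2' x hx]
  · simp only [gdual, pdual, del]
    split_ifs
    · rfl
    · exact (delSkip_colour G B c h1 h2 _ _).trans (h1 x)
  · simp [gdual, pdual, del, hB0 x hx, h0' x hx]

end RibbonGraph

open RibbonGraph in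
/-- **Lemma (Statement 7).** If the partial dual `G^A` is bipartite, then
`(G − Aᶜ)*` and `(G* − A)*` are both bipartite. -/
theorem bipartite_of_pdual_bipartite (G : RibbonGraph) (hG : G.IsRibbon)
    (A : Set G.flags) (hA : G.IsEdgeSet A) (h : (G.pdual A).Bipartite) :
    ((G.del Aᶜ).gdual).Bipartite ∧ ((G.gdual.del A).gdual).Bipartite := by
  obtain ⟨-, i0, -, i2, -⟩ := hG
  obtain ⟨c, hc⟩ := h
  change G.flags → Bool at c
  have c1 : ∀ x, c (G.t1 x) = c x := fun x => (hc x).2.1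
  have c0_mem : ∀ x ∈ A, c (G.t0 x) = c x := fun x hx =>
    (congrArg c (if_pos hx).symm).trans (hc x).2.2
  have c2_mem : ∀ x ∈ A, c (G.t2 x) = !c x := fun x hx =>
    (congrArg c (if_pos hx).symm).trans (hc x).1
  have c0_notMem : ∀ x ∉ A, c (G.t0 x) = !c x := fun x hx =>
    (congrArg c (if_neg hx).symm).trans (hc x).1
  have c2_notMem : ∀ x ∉ A, c (G.t2 x) = c x := fun x hx =>
    (congrArg c (if_neg hx).symm).trans (hc x).2.2
  have hA0 : ∀ x ∉ A, G.t0 x ∉ A := fun x hx h' => hx (i0 x ▸ (hA _ h').1)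
  have hA2 : ∀ x ∉ A, G.t2 x ∉ A := fun x hx h' => hx (i2 x ▸ (hA _ h').2)
  constructor
  · refine bipartite_gdual_del G Aᶜ c ?_ ?_ c1 c2_notMem ?_ ?_
    · exact fun x hx => not_not.2 (hA x (not_not.1 hx)).1
    · exact fun x hx => not_not.2 (hA x (not_not.1 hx)).2
    · exact fun x hx => c0_mem x (not_not.1 hx)
    · exact fun x hx => c2_mem x (not_not.1 hx)
  · have e0 : ∀ x, G.gdual.t0 x = G.t2 x := fun x => if_pos (Set.mem_univ x)
    have e2 : ∀ x, G.gdual.t2 x = G.t0 x := fun x => if_pos (Set.mem_univ x)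
    refine bipartite_gdual_del G.gdual A c ?_ ?_ c1 ?_ ?_ ?_
    · exact fun x hx => e0 x ▸ hA2 x hx
    · exact fun x hx => e2 x ▸ hA0 x hx
    · exact fun x hx => (congrArg c (e2 x)).trans (c0_mem x hx)
    · exact fun x hx => (congrArg c (e0 x)).trans (c2_notMem x hx)
    · exact fun x hx => (congrArg c (e2 x)).trans (c0_notMem x hx)
end

section
/- Let G be an embedded graph. If G and its Petrial G^× are both orientable, then G is bipartite, and hence the geometric dual G* is checkerboard colourable. -/
namespace RibbonGraph

theorem Bipartite.gdual_checkerboardColourable {G : RibbonGraph} (h : G.Bipartite) :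
    G.gdual.CheckerboardColourable := by
  obtain ⟨c, hc⟩ := h
  refine ⟨c, fun (x : G.flags) => ?_⟩
  obtain ⟨h0, h1, h2⟩ := hc x
  simp [gdual, pdual, h0, h1, h2]

/-- The exclusive or of proper flag colourings of `G` and its Petrial is constant on vertices and
changes along edges. -/
theorem Orientable.bipartite_of_petrial {G : RibbonGraph} (ht2 : Function.Involutive G.t2)
    (hG : G.Orientable) (hP : G.petrial.Orientable) : G.Bipartite := by
  obtain ⟨c, hc⟩ := hG
  obtain ⟨d, hd⟩ := hP
  have hd' (x : G.flags) :
      d (G.t0 (G.t2 x)) = !d x ∧ d (G.t1 x) = !d x ∧ d (G.t2 x) = !d x := by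
    simpa [petrial, ppetrial] using hd x
  have hd0 (x : G.flags) : d (G.t0 x) = d x := by
    have h := (hd' (G.t2 x)).1
    rwa [ht2 x, (hd' x).2.2, Bool.not_not] at h
  refine ⟨fun x => xor (c x) (d x), fun x => ?_⟩
  obtain ⟨c0, c1, c2⟩ := hc x
  obtain ⟨-, d1, d2⟩ := hd' x
  simp [c0, c1, c2, hd0 x, d1, d2]

end RibbonGraph

open RibbonGraph in
/-- If `G` and its Petrial `G^×` are both orientable, then
`G` is bipartite, and hence the geometric dual `G*` is checkerboard
colourable. -/
theorem bipartite_of_orientable_of_petrial_orientable (G : RibbonGraph)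
    (hG : G.IsRibbon) (h1 : G.Orientable) (h2 : G.petrial.Orientable) :
    G.Bipartite ∧ G.gdual.CheckerboardColourable := by
  obtain ⟨-, -, -, ht2, -⟩ := hG
  have hB := h1.bipartite_of_petrial ht2 h2
  exact ⟨hB, hB.gdual_checkerboardColourable⟩
end

section
/- For every ribbon graph G there exists a subset A ⊆ E(G) such that the partial Petrial G^{τ(A)} is orientable. -/
/-- Writing `p = a * b` for a product of fixed-point-free involutions, no point `x` lies in the same
`p`-cycle as `a x`: the dihedral group generated by `a` and `b` contains no reflection
with a fixed point. -/
theorem not_sameCycle_mul_of_involutive {α : Type*} {a b : Equiv.Perm α}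
    (ha : Function.Involutive a) (hb : Function.Involutive b)
    (ha' : ∀ x, a x ≠ x) (hb' : ∀ x, b x ≠ x) (x : α) :
    ¬ (a * b).SameCycle x (a x) := by
  rintro ⟨n, hn⟩
  have haa : a * a = 1 := Equiv.ext ha
  have hbb : b * b = 1 := Equiv.ext hb
  have hconj : SemiconjBy a (a * b) (a * b)⁻¹ := by
    rw [SemiconjBy, mul_inv_rev, inv_eq_of_mul_eq_one_right haa,
      inv_eq_of_mul_eq_one_right hbb, ← mul_assoc, haa, one_mul, mul_assoc, haa, mul_one]
  have hpow (k : ℤ) : a (((a * b) ^ k) x) = ((a * b) ^ (n - k)) x := by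
    have h : a * (a * b) ^ k = ((a * b)⁻¹) ^ k * a := (hconj.zpow_right k).eq
    rw [← Equiv.Perm.mul_apply, h, Equiv.Perm.mul_apply, ← hn, ← Equiv.Perm.mul_apply,
      inv_zpow', ← zpow_add, neg_add_eq_sub]
  obtain ⟨k, rfl | rfl⟩ := Int.even_or_odd' n
  · exact ha' _ ((hpow k).trans (by rw [two_mul, add_sub_cancel_right]))
  · refine hb' (((a * b) ^ k) x) (a.injective ?_)
    rw [hpow k, show 2 * k + 1 - k = 1 + k by ring, zpow_add, zpow_one]
    rfl

/-- Two fixed-point-free involutions of a type admit a common proper two-colouring. -/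
theorem exists_bool_coloring_of_involutive {α : Type*} {a b : α → α}
    (ha : Function.Involutive a) (hb : Function.Involutive b)
    (ha' : ∀ x, a x ≠ x) (hb' : ∀ x, b x ≠ x) :
    ∃ c : α → Bool, ∀ x, c (a x) = !c x ∧ c (b x) = !c x := by
  classical
  let p : Equiv.Perm α := ha.toPerm a * hb.toPerm b
  let π : α → Quotient (Equiv.Perm.SameCycle.setoid p) := Quotient.mk _
  let : LinearOrder (Quotient (Equiv.Perm.SameCycle.setoid p)) :=
    linearOrderOfSTO WellOrderingRel
  have hp (x : α) : π (a (b x)) = π x :=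
    Quotient.sound (Equiv.Perm.sameCycle_apply_left.2 (Equiv.Perm.SameCycle.refl p x))
  have hab (x : α) : π (b x) = π (a x) := by rw [← hp (b x), hb x]
  have hne (x : α) : π x ≠ π (a x) := fun h =>
    not_sameCycle_mul_of_involutive (a := ha.toPerm a) (b := hb.toPerm b) ha hb ha' hb' x
      (Quotient.exact h)
  have hlt (x : α) : decide (π (a x) < π x) = !decide (π x < π (a x)) := by
    rw [← decide_not, decide_eq_decide, not_lt, le_iff_lt_or_eq, or_iff_left (hne x).symm]
  refine ⟨fun x => decide (π x < π (a x)), fun x => ⟨?_, ?_⟩⟩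
  · simpa only [ha x] using hlt x
  · simpa only [hab x, hp x] using hlt x

open RibbonGraph in
/-- Every ribbon graph has an orientable partial Petrial. -/
theorem exists_orientable_partial_petrial (G : RibbonGraph) (hG : G.IsRibbon) :
    ∃ A : Set G.flags, G.IsEdgeSet A ∧ (G.ppetrial A).Orientable := by
  obtain ⟨-, h0, h1, h2, h02, -, h1', h2', -⟩ := hG
  obtain ⟨c, hc⟩ := exists_bool_coloring_of_involutive h1 h2 h1' h2'
  have hc02 (x : G.flags) : c (G.t0 (G.t2 x)) = !c (G.t0 x) := by rw [h02, (hc _).2]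
  refine ⟨{x | c (G.t0 x) = c x}, fun x hx => ⟨?_, ?_⟩, c, fun x => ⟨?_, hc x⟩⟩
  · simpa only [Set.mem_ofPred_eq, h0 x] using Eq.symm hx
  · simpa only [Set.mem_ofPred_eq, hc02, (hc x).2, Bool.not_inj_iff] using hx
  · by_cases hx : c (G.t0 x) = c x
    · simpa [ppetrial, hx] using hc02 x
    · simpa [ppetrial, hx] using Bool.eq_not_of_ne hx
end

section
/- Let G be an embedded graph and A ⊆ E(G). Then (G − A^c)* = G^A − A^c and (G* − A)* = G^A − A, where A^c = E(G) \ A. -/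
namespace RibbonGraph

/-- Skipping over the edges of `B` only depends on `t1` and on the values of `t2` on `B`. -/
theorem delSkip_congr_s10 {F : Type} (a0 b0 t a2 b2 : F → F) {B : Set F}
    (h : ∀ y ∈ B, a2 y = b2 y) (n : ℕ) (y : F) :
    delSkip ⟨F, a0, t, a2⟩ B n y = delSkip ⟨F, b0, t, b2⟩ B n y := by
  induction n generalizing y with
  | zero => rfl
  | succ n ih =>
    by_cases hy : y ∈ B
    · simp only [delSkip, if_pos hy, h y hy, ih]
    · simp only [delSkip, if_neg hy]

open Classical in
theorem dite_mk_congr {F : Type} {B : Set F} {x : {x : F // x ∉ B}} {a b : F} (hab : a = b) :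
    (if h : a ∉ B then (⟨a, h⟩ : {x : F // x ∉ B}) else x) = if h : b ∉ B then ⟨b, h⟩ else x := by
  subst hab
  rfl

/-- If two flag systems have the same `t1` and, with respect to a set `B` of edges, have the same
`t2` on `B` and interchanged `t0` and `t2` off `B`, then deleting `B` makes them geometric duals. -/
theorem iso_gdual_del {F : Type} (a0 b0 t a2 b2 : F → F) {B : Set F}
    (hB : ∀ y ∈ B, a2 y = b2 y) (h0 : ∀ y ∉ B, a2 y = b0 y) (h2 : ∀ y ∉ B, a0 y = b2 y) :
    Iso ((del ⟨F, a0, t, a2⟩ B).gdual) (del ⟨F, b0, t, b2⟩ B) := by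
  refine ⟨Equiv.refl {x : F // x ∉ B}, fun x => ?_, fun x => ?_, fun x => ?_⟩
  · exact (if_pos (Set.mem_univ x)).trans (dite_mk_congr (h0 x.1 x.2))
  · exact dite_mk_congr (delSkip_congr_s10 a0 b0 t a2 b2 hB _ _)
  · exact (if_pos (Set.mem_univ x)).trans (dite_mk_congr (h2 x.1 x.2))

end RibbonGraph

open RibbonGraph in
/-- For any embedded graph `G` and `A ⊆ E(G)`,
`(G − Aᶜ)* = G^A − Aᶜ` and `(G* − A)* = G^A − A`. -/
theorem gdual_del_eq_pdual_del (G : RibbonGraph) (hG : G.IsRibbon)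
    (A : Set G.flags) (hA : G.IsEdgeSet A) :
    RibbonGraph.Iso ((G.del Aᶜ).gdual) ((G.pdual A).del Aᶜ) ∧
      RibbonGraph.Iso ((G.gdual.del A).gdual) ((G.pdual A).del A) := by
  constructor
  · refine iso_gdual_del G.t0 _ G.t1 G.t2 _ (fun y hy => ?_) (fun y hy => ?_) (fun y hy => ?_)
    · exact (if_neg hy).symm
    · exact (if_pos (not_not.mp hy)).symm
    · exact (if_pos (not_not.mp hy)).symm
  · refine iso_gdual_del _ _ G.t1 _ _ (fun y hy => ?_) (fun y hy => ?_) (fun y hy => ?_)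
    · exact (if_pos (Set.mem_univ y)).trans (if_pos hy).symm
    · exact (if_pos (Set.mem_univ y)).trans (if_neg hy).symm
    · exact (if_pos (Set.mem_univ y)).trans (if_neg hy).symm
end

section
/- Let G be an orientable ribbon graph and let D be the set of d-edges of G arising from an all-crossing direction of the medial graph G_m. Then the partial dual G^{δ(D)} is checkerboard colourable. -/
open RibbonGraph in
/-- If `G` is an orientable ribbon graph and `D` is the set
of `d`-edges arising from an all-crossing direction of the medial graph
`G_m`, then the partial dual `G^{δ(D)}` is checkerboard colourable. -/
theorem pdual_dEdges_checkerboard (G : RibbonGraph) (hG : G.IsRibbon)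
    (hor : G.Orientable) (o : G.flags → Bool) (ho : G.IsAllCrossing o) :
    (G.pdual (G.dEdges o)).CheckerboardColourable := by
  obtain ⟨-, -, -, h2, -⟩ := hG
  obtain ⟨c, hc⟩ := hor
  obtain ⟨ho1, ho02⟩ := ho
  refine ⟨fun x => xor (c x) (o x), fun (x : G.flags) => ?_⟩
  have h : o (G.t2 x) = !o (G.t0 x) := by
    have := ho02 (G.t2 x)
    rw [h2 x] at this
    simp [this]
  obtain ⟨c0, c1, c2⟩ := hc x
  have o1 := ho1 x
  by_cases hx : o (G.t0 x) = o x
  · simp [pdual, dEdges, hx, c0, c1, c2, o1, h]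
  · have hx' : o (G.t0 x) = !o x := Bool.eq_not.mpr hx
    simp [pdual, dEdges, c0, c1, c2, o1, h, hx']
end
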